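/- arXiv:q-alg/9711025 — 5 statements merged into one kernel-verified Lean document; each statement's English description precedes it below -/
import Mathlib

section
/- Let a and b be natural numbers. Let e₁ : Lex (Fin a × Fin b) ≃o Fin (a·b) and e₂ : Lex (Fin b × Fin a) ≃o Fin (b·a) be the unique order isomorphisms from the lexicographically ordered products to the corresponding canonical finite linear orders. Then the permutation of Fin (a·b) given by e₂ ∘ Prod.swap ∘ e₁⁻¹ (composed with the canonical identification of Fin (b·a) with Fin (a·b)) has sign (-1)^(C(a,2)·C(b,2)), where C(n,2) = n(n-1)/2 denotes the binomial coefficient. -/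
theorem Equiv.Perm.sign_eq_neg_one_pow_card_inversions {n : ℕ} (σ : Equiv.Perm (Fin n)) :
    Equiv.Perm.sign σ =
      (-1 : ℤˣ) ^ (Finset.univ.filter fun p : Fin n × Fin n => p.1 < p.2 ∧ σ p.2 < σ p.1).card := by
  rw [σ.sign_eq_prod_prod_Ioi, ← Finset.prod_const, Finset.prod_filter, Fintype.prod_prod_type]
  refine Finset.prod_congr rfl fun i _ => ?_
  rw [← Finset.filter_lt_eq_Ioi, Finset.prod_filter]
  refine Finset.prod_congr rfl fun j _ => ?_
  by_cases hij : i < j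
  · have hne : σ i ≠ σ j := σ.injective.ne hij.ne
    rcases hne.lt_or_gt with h | h <;> simp [hij, h, h.not_gt]
  · simp [hij]

theorem Fin.card_filter_fst_lt_snd (n : ℕ) :
    (Finset.univ.filter fun p : Fin n × Fin n => p.1 < p.2).card = n.choose 2 := by
  rw [Finset.card_filter, Fintype.sum_prod_type_right, Nat.choose_two_right,
    ← Finset.sum_range_id]
  simp_rw [← Finset.card_filter, Finset.filter_gt_eq_Iio, Fin.card_Iio]
  exact Fin.sum_univ_eq_sum_range (fun i => i) n

theorem Prod.Lex.lt_and_swap_gt_iff {α β : Type*} [LinearOrder α] [LinearOrder β] (x y : α × β) :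
    toLex x < toLex y ∧ toLex y.swap < toLex x.swap ↔ x.1 < y.1 ∧ y.2 < x.2 := by
  simp only [Prod.Lex.toLex_lt_toLex, Prod.fst_swap, Prod.snd_swap]
  grind

/-- The sign of the unique order-preserving bijection between the
lexicographically ordered sets `Fin a × Fin b` and `Fin b × Fin a` (the swap of
factors), viewed as a permutation of `Fin (a*b)` via the unique order
isomorphisms with `Fin (a*b)` and `Fin (b*a)`, is `(-1)^(C(a,2)*C(b,2))`. -/
theorem sign_of_lex_swap (a b : ℕ)
    (e₁ : (Fin a ×ₗ Fin b) ≃o Fin (a * b))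
    (e₂ : (Fin b ×ₗ Fin a) ≃o Fin (b * a)) :
    Equiv.Perm.sign
      (e₁.toEquiv.symm.trans
        ((ofLex.trans ((Equiv.prodComm (Fin a) (Fin b)).trans toLex)).trans
          (e₂.toEquiv.trans (finCongr (Nat.mul_comm b a))))) =
      (-1 : ℤˣ) ^ (a.choose 2 * b.choose 2) := by
  rw [Equiv.Perm.sign_eq_neg_one_pow_card_inversions, ← Fin.card_filter_fst_lt_snd a,
    ← Fin.card_filter_fst_lt_snd b, ← Finset.card_product]
  congr 1
  symm
  refine Finset.card_nbij'
    (fun q => (e₁ (toLex (q.1.1, q.2.2)), e₁ (toLex (q.1.2, q.2.1))))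
    (fun p => (((ofLex (e₁.symm p.1)).1, (ofLex (e₁.symm p.2)).1),
      ((ofLex (e₁.symm p.2)).2, (ofLex (e₁.symm p.1)).2))) ?_ ?_ ?_ ?_
  · rintro ⟨⟨i, i'⟩, j', j⟩ h
    have := (Prod.Lex.lt_and_swap_gt_iff (i, j) (i', j')).2 (by simpa using h)
    simpa using this
  · rintro ⟨x, y⟩ h
    have := (Prod.Lex.lt_and_swap_gt_iff (ofLex (e₁.symm x)) (ofLex (e₁.symm y))).1
      (by simpa using h)
    simpa using this
  · intro q _
    simp
  · intro p _
    simp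
end

section
/- Let p and q be natural numbers and N : Fin p × Fin q → ℕ. Let T = Σ_{(a,b) ∈ Fin p × Fin q} Fin (N(a,b)) be the disjoint union of blocks, and let M = Σ_{a,b} N(a,b). Let u₁ : T ≃ Fin M be the enumeration of T that is monotone when the blocks are ordered lexicographically by (a,b) (first by a, then by b) and each block internally by its Fin order, and let u₂ : T ≃ Fin M be the enumeration that is monotone when the blocks are ordered lexicographically by (b,a) and each block internally by its Fin order. Then the permutation u₂ ∘ u₁⁻¹ of Fin M has sign (-1)^E, where E = Σ_{a₁ > a₂, b₁ < b₂} N(a₁,b₁)·N(a₂,b₂), the sum being over all a₁,a₂ ∈ Fin p with a₁ > a₂ and all b₁,b₂ ∈ Fin q with b₁ < b₂. -/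
/-- The sign of the permutation comparing two enumerations counts the pairs that
the enumerations order differently. -/
theorem sign_symm_trans_eq_prod_inversions {α : Type*} [Fintype α] {n : ℕ} (u v : α ≃ Fin n) :
    Equiv.Perm.sign (u.symm.trans v) =
      ∏ s, ∏ t, if u s < u t ∧ v t < v s then (-1 : ℤˣ) else 1 := by
  rw [Equiv.Perm.sign_eq_prod_prod_Ioi, ← u.prod_comp]
  refine Finset.prod_congr rfl fun s _ => ?_
  rw [← Finset.filter_lt_eq_Ioi, Finset.prod_filter, ← u.prod_comp]
  refine Finset.prod_congr rfl fun t _ => ?_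
  by_cases hu : u s < u t
  · have hv : v s ≠ v t := fun h => hu.ne (congrArg u (v.injective h))
    rcases lt_or_gt_of_ne hv with h | h
    · simp [hu, h, h.not_gt]
    · simp [hu, h, h.not_gt]
  · simp [hu]

/-- A map that is strictly monotone for a trichotomous relation reflects it. -/
theorem lt_iff_of_trichotomous {α β : Type*} [Preorder β] {r : α → α → Prop} {f : α → β}
    (hf : ∀ s t, r s t → f s < f t) (hr : ∀ s t, r s t ∨ s = t ∨ r t s) (s t : α) :
    f s < f t ↔ r s t := by
  refine ⟨fun h => ?_, hf s t⟩
  rcases hr s t with h' | rfl | h'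
  · exact h'
  · exact (lt_irrefl _ h).elim
  · exact (h.not_gt (hf t s h')).elim


theorem prod_sigma_fin_fst {ι R : Type*} [Fintype ι] [CommMonoid R] (N : ι → ℕ) (f : ι → R) :
    ∏ x : (i : ι) × Fin (N i), f x.1 = ∏ i, f i ^ N i := by
  simp [Fintype.prod_sigma]

/-- For `N : Fin p × Fin q → ℕ`, let `T = Σ_{(a,b)} Fin (N (a,b))`
and `M = Σ N`.  If `u₁ : T ≃ Fin M` is monotone for the ordering of blocks
lexicographically by `(a,b)` and `u₂ : T ≃ Fin M` is monotone for the ordering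
of blocks lexicographically by `(b,a)` (each block internally in its `Fin`
order), then the permutation `u₂ ∘ u₁⁻¹` of `Fin M` has sign `(-1)^E` where
`E = Σ_{a₁ > a₂, b₁ < b₂} N(a₁,b₁) * N(a₂,b₂)`. -/
theorem sign_of_block_reorder (p q : ℕ) (N : Fin p × Fin q → ℕ)
    (M : ℕ) (hM : M = ∑ ab : Fin p × Fin q, N ab)
    (u₁ u₂ : ((ab : Fin p × Fin q) × Fin (N ab)) ≃ Fin M)
    (h₁ : ∀ s t : (ab : Fin p × Fin q) × Fin (N ab),
      (Prod.Lex (· < ·) (· < ·) s.1 t.1 ∨ (s.1 = t.1 ∧ s.2.val < t.2.val)) →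
        u₁ s < u₁ t)
    (h₂ : ∀ s t : (ab : Fin p × Fin q) × Fin (N ab),
      (Prod.Lex (· < ·) (· < ·) s.1.swap t.1.swap ∨
        (s.1 = t.1 ∧ s.2.val < t.2.val)) →
        u₂ s < u₂ t) :
    Equiv.Perm.sign (u₁.symm.trans u₂) =
      (-1 : ℤˣ) ^
        (∑ a₁ : Fin p, ∑ a₂ : Fin p, ∑ b₁ : Fin q, ∑ b₂ : Fin q,
          if a₂ < a₁ ∧ b₁ < b₂ then N (a₁, b₁) * N (a₂, b₂) else 0) := by
  have tri : ∀ s t : (ab : Fin p × Fin q) × Fin (N ab),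
      s.1 = t.1 → s.2.val < t.2.val ∨ s = t ∨ t.2.val < s.2.val := by
    rintro ⟨x, i⟩ ⟨y, j⟩ (rfl : x = y)
    rcases lt_trichotomy i j with h | rfl | h
    · exact Or.inl h
    · exact Or.inr (Or.inl rfl)
    · exact Or.inr (Or.inr h)
  have e₁ := lt_iff_of_trichotomous h₁ fun s t => by
    have := tri s t
    simp only [Prod.lex_def, Prod.ext_iff] at this ⊢
    grind
  have e₂ := lt_iff_of_trichotomous h₂ fun s t => by
    have := tri s t
    simp only [Prod.lex_def, Prod.ext_iff, Prod.fst_swap, Prod.snd_swap] at this ⊢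
    grind
  have inv : ∀ s t : (ab : Fin p × Fin q) × Fin (N ab),
      (u₁ s < u₁ t ∧ u₂ t < u₂ s) ↔ (s.1.1 < t.1.1 ∧ t.1.2 < s.1.2) := by
    intro s t
    rw [e₁, e₂]
    simp only [Prod.lex_def, Prod.ext_iff, Prod.fst_swap, Prod.snd_swap]
    grind
  have key : Equiv.Perm.sign (u₁.symm.trans u₂) =
      ∏ x, (∏ y, (if y.1 < x.1 ∧ x.2 < y.2 then (-1 : ℤˣ) else 1) ^ N y) ^ N x := by
    rw [sign_symm_trans_eq_prod_inversions, Finset.prod_comm,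
      ← prod_sigma_fin_fst N fun x => ∏ y, (if y.1 < x.1 ∧ x.2 < y.2 then (-1 : ℤˣ) else 1) ^ N y]
    refine Finset.prod_congr rfl fun t _ => ?_
    rw [← prod_sigma_fin_fst N fun y => if y.1 < t.1.1 ∧ t.1.2 < y.2 then (-1 : ℤˣ) else 1]
    exact Finset.prod_congr rfl fun s _ => if_congr (inv s t) rfl rfl
  rw [key]
  simp only [Fintype.prod_prod_type, ← Finset.prod_pow_eq_pow_sum, ← Finset.prod_pow]
  refine Finset.prod_congr rfl fun a₁ _ => ?_
  rw [Finset.prod_comm]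
  refine Finset.prod_congr rfl fun a₂ _ => Finset.prod_congr rfl fun b₁ _ =>
    Finset.prod_congr rfl fun b₂ _ => ?_
  split_ifs
  · rw [← pow_mul, mul_comm]
  · simp
end

section
/- Let k be a field and H a nonzero finite-dimensional k-vector space. There exists a linear automorphism Φ : H ≃ H such that the flip map H ⊗_k H → H ⊗_k H, g ⊗ h ↦ h ⊗ g, equals (Φ ∘ Φ) ⊗ id_H (i.e., for all g, h ∈ H, h ⊗ g = Φ(Φ(g)) ⊗ h) if and only if dim_k H = 1. -/
open TensorProduct

/-- For a nonzero finite-dimensional vector space `H` over a field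
`k`, there is a linear automorphism `Φ` of `H` with
`flip = (Φ ∘ Φ) ⊗ id`, i.e. `h ⊗ g = Φ(Φ g) ⊗ h` for all `g h`,
iff `dim_k H = 1`. -/
theorem flip_eq_sq_tensor_id_iff_dim_one
    (k : Type*) [Field k] (H : Type*) [AddCommGroup H] [Module k H]
    [FiniteDimensional k H] [Nontrivial H] :
    (∃ Φ : H ≃ₗ[k] H, ∀ g h : H,
        (h ⊗ₜ[k] g : H ⊗[k] H) = (Φ (Φ g)) ⊗ₜ[k] h) ↔
      Module.finrank k H = 1 := by
  constructor
  · rintro ⟨Φ, hΦ⟩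
    let b := Module.finBasis k H
    have hsub : Subsingleton (Fin (Module.finrank k H)) := by
      refine ⟨fun i j => by_contra fun hij => ?_⟩
      have h := congrArg (LinearMap.mul' k k ∘ₗ TensorProduct.map (b.coord j) (b.coord i))
        (hΦ (b i) (b j))
      simp [Finsupp.single_eq_of_ne hij] at h
    have hle := Fin.subsingleton_iff_le_one.mp hsub
    have hpos := Module.finrank_pos (R := k) (M := H)
    omega
  · intro hdim
    obtain ⟨v, -, hv⟩ := finrank_eq_one_iff'.mp hdim
    refine ⟨LinearEquiv.refl k H, fun g h => ?_⟩
    obtain ⟨a, rfl⟩ := hv g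
    obtain ⟨c, rfl⟩ := hv h
    simp [TensorProduct.smul_tmul', TensorProduct.tmul_smul, smul_smul, mul_comm]
end

section
/- Let m, n ∈ ℤ, A = ℤ[X]/(X² − mX − n), and B = A ⊗_ℤ A (a commutative ring). Let u = x ⊗ 1 − 1 ⊗ x and v = x ⊗ 1 + 1 ⊗ x − m·(1 ⊗ 1) in B, where x is the image of X in A. Then the annihilator of u in B is the principal ideal generated by v: {z ∈ B : z·u = 0} = v·B. -/
open Polynomial TensorProduct

/-- The enveloping ring `A = ℤ[X]/(X² − mX − n)` of the two-element fusion ring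
`{e, x}` with `x*x = m·x + n·e`. -/
abbrev EnvRing (m n : ℤ) : Type :=
  Polynomial ℤ ⧸ Ideal.span ({X ^ 2 - C m * X - C n} : Set (Polynomial ℤ))

/-- The image of `X` in `A = ℤ[X]/(X² − mX − n)`. -/
noncomputable def envX (m n : ℤ) : EnvRing m n :=
  Ideal.Quotient.mk _ X

theorem envX_sq (m n : ℤ) : envX m n ^ 2 = m * envX m n + n := by
  have h : Ideal.Quotient.mk (Ideal.span {X ^ 2 - C m * X - C n}) (X ^ 2 - C m * X - C n) = 0 :=
    Ideal.Quotient.eq_zero_iff_mem.2 (Ideal.mem_span_singleton_self _)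
  simp only [map_sub, map_mul, map_pow, eq_intCast, map_intCast] at h
  rw [envX]
  linear_combination h

theorem exists_basis_one_envX (m n : ℤ) :
    ∃ b : Module.Basis (Fin 2) ℤ (EnvRing m n), b 0 = 1 ∧ b 1 = envX m n := by
  have hdeg : (X ^ 2 - C m * X - C n : ℤ[X]).natDegree = 2 := by compute_degree!
  have hmonic : (X ^ 2 - C m * X - C n : ℤ[X]).Monic := by monicity!
  let pb := AdjoinRoot.powerBasis' hmonic
  let b := pb.basis.reindex (finCongr hdeg)
  refine ⟨b, ?_, ?_⟩
  · change pb.basis.reindex (finCongr hdeg) 0 = 1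
    rw [Module.Basis.reindex_apply, pb.basis_eq_pow]
    exact pow_zero _
  · change pb.basis.reindex (finCongr hdeg) 1 = AdjoinRoot.root _
    rw [Module.Basis.reindex_apply, pb.basis_eq_pow]
    exact pow_one _

/-- In a free `A`-algebra with basis `1, y`, where `x` and `y` are roots of the same monic
quadratic, the annihilator of `x - y` is generated by `x + y - m`. -/
theorem mul_sub_eq_zero_iff_dvd {A B : Type*} [CommRing A] [CommRing B] [Algebra A B]
    (c : Module.Basis (Fin 2) A B) (y : B) (h0 : c 0 = 1) (h1 : c 1 = y) (x m n : A)
    (hx : x ^ 2 = m * x + n) (hy : y ^ 2 = algebraMap A B m * y + algebraMap A B n) (z : B) :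
    z * (algebraMap A B x - y) = 0 ↔ algebraMap A B x + y - algebraMap A B m ∣ z := by
  have hx' := congrArg (algebraMap A B) hx
  simp only [map_pow, map_add, map_mul] at hx'
  constructor
  · intro hz
    obtain ⟨p, q, rfl⟩ : ∃ p q : A, z = algebraMap A B p + algebraMap A B q * y := by
      refine ⟨c.repr z 0, c.repr z 1, ?_⟩
      conv_lhs => rw [← c.sum_repr z]
      simp [Fin.sum_univ_two, h0, h1, Algebra.smul_def]
    have hli := Fintype.linearIndependent_iff.1 c.linearIndependent
      ![p * x - q * n, q * x - p - q * m] (by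
        simp only [Fin.sum_univ_two, h0, h1, Algebra.smul_def, Matrix.cons_val_zero,
          Matrix.cons_val_one, map_sub, map_mul]
        linear_combination hz + algebraMap A B q * hy) 1
    have hp : p = q * x - q * m := by
      simp only [Matrix.cons_val_one, Matrix.cons_val_zero] at hli
      linear_combination -hli
    refine ⟨algebraMap A B q, ?_⟩
    rw [hp]
    simp only [map_sub, map_mul]
    ring
  · rintro ⟨w, rfl⟩
    linear_combination w * (hx' - hy)

/-- If `A` is free over `R` on `1, x` with `x ^ 2 = m • x + n • 1`, the annihilator of
`x ⊗ 1 - 1 ⊗ x` in `A ⊗[R] A` is generated by `x ⊗ 1 + 1 ⊗ x - m • (1 ⊗ 1)`. -/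
theorem tmul_one_sub_annihilator {R A : Type*} [CommRing R] [CommRing A] [Algebra R A]
    (b : Module.Basis (Fin 2) R A) (x : A) (h0 : b 0 = 1) (h1 : b 1 = x) (m n : R)
    (hx : x ^ 2 = m • x + n • 1) (z : A ⊗[R] A) :
    z * (x ⊗ₜ[R] 1 - 1 ⊗ₜ[R] x) = 0 ↔
      z ∈ Ideal.span {x ⊗ₜ[R] 1 + 1 ⊗ₜ[R] x - m • ((1 : A) ⊗ₜ[R] (1 : A))} := by
  have hx' : x ^ 2 = algebraMap R A m * x + algebraMap R A n := by
    rw [hx, Algebra.smul_def, Algebra.algebraMap_eq_smul_one n]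
  have hy : ((1 : A) ⊗ₜ[R] x) ^ 2 =
      algebraMap A (A ⊗[R] A) (algebraMap R A m) * ((1 : A) ⊗ₜ[R] x) +
        algebraMap A (A ⊗[R] A) (algebraMap R A n) := by
    rw [Algebra.TensorProduct.tmul_pow, one_pow, hx, TensorProduct.tmul_add,
      TensorProduct.tmul_smul, TensorProduct.tmul_smul, ← Algebra.TensorProduct.one_def,
      ← IsScalarTower.algebraMap_apply, ← IsScalarTower.algebraMap_apply,
      Algebra.smul_def, Algebra.smul_def, mul_one]
  rw [Ideal.mem_span_singleton, ← Algebra.TensorProduct.one_def,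
    ← Algebra.algebraMap_eq_smul_one, IsScalarTower.algebraMap_apply R A (A ⊗[R] A)]
  exact mul_sub_eq_zero_iff_dvd (Algebra.TensorProduct.basis A b) _
    (by rw [Algebra.TensorProduct.basis_apply, h0]; rfl)
    (by rw [Algebra.TensorProduct.basis_apply, h1]) x _ _ hx' hy z

/-- in `B = A ⊗_ℤ A`, with `u = x ⊗ 1 − 1 ⊗ x` and
`v = x ⊗ 1 + 1 ⊗ x − m·(1 ⊗ 1)`, the annihilator of `u` is the principal
ideal generated by `v`. -/
theorem annihilator_u_eq_span_v (m n : ℤ) :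
    let B := EnvRing m n ⊗[ℤ] EnvRing m n
    let u : B := envX m n ⊗ₜ[ℤ] 1 - 1 ⊗ₜ[ℤ] envX m n
    let v : B := envX m n ⊗ₜ[ℤ] 1 + 1 ⊗ₜ[ℤ] envX m n -
      (m : ℤ) • ((1 : EnvRing m n) ⊗ₜ[ℤ] (1 : EnvRing m n))
    ∀ z : B, z * u = 0 ↔ z ∈ Ideal.span ({v} : Set B) := by
  obtain ⟨b, h0, h1⟩ := exists_basis_one_envX m n
  exact tmul_one_sub_annihilator b (envX m n) h0 h1 m n (by simpa using envX_sq m n)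
end

section
/- Let m, n ∈ ℤ, A = ℤ[X]/(X² − mX − n), and B = A ⊗_ℤ A (a commutative ring). Let u = x ⊗ 1 − 1 ⊗ x and v = x ⊗ 1 + 1 ⊗ x − m·(1 ⊗ 1) in B, where x is the image of X in A. Then the annihilator of v in B is the principal ideal generated by u: {z ∈ B : z·v = 0} = u·B. -/
open Polynomial TensorProduct

namespace Algebra.TensorProduct

variable {R A : Type*} [CommRing R] [CommRing A] [Algebra R A] {x : A}

theorem exists_eq_tmul_one_add_tmul (hspan : ∀ t : A, ∃ p q : R, t = p • 1 + q • x)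
    (z : A ⊗[R] A) : ∃ a b : A, z = a ⊗ₜ[R] 1 + b ⊗ₜ[R] x := by
  induction z using TensorProduct.induction_on with
  | zero => exact ⟨0, 0, by simp⟩
  | tmul s t =>
    obtain ⟨p, q, rfl⟩ := hspan t
    exact ⟨p • s, q • s, by simp only [TensorProduct.tmul_add, TensorProduct.tmul_smul,
      TensorProduct.smul_tmul']⟩
  | add z w hz hw =>
    obtain ⟨a, b, rfl⟩ := hz
    obtain ⟨c, d, rfl⟩ := hw
    exact ⟨a + c, b + d, by simp only [TensorProduct.add_tmul]; abel⟩

/-- If `A` is free over `R` with basis `1, x` and `x * x = m • x + n • 1`, then the annihilator of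
`x ⊗ 1 + 1 ⊗ x - m` in `A ⊗ A` is generated by `x ⊗ 1 - 1 ⊗ x`. Linear independence of `1, x`
enters through the coordinate functional `φ`. -/
theorem mul_eq_zero_iff_mem_span_of_quadratic {m n : R} (hx : x * x = m • x + n • 1)
    (hspan : ∀ t : A, ∃ p q : R, t = p • 1 + q • x)
    (φ : A →ₗ[R] R) (φ_one : φ 1 = 0) (φ_x : φ x = 1) (z : A ⊗[R] A) :
    z * (x ⊗ₜ[R] 1 + 1 ⊗ₜ[R] x - m • (1 ⊗ₜ[R] 1)) = 0 ↔
      z ∈ Ideal.span {x ⊗ₜ[R] (1 : A) - (1 : A) ⊗ₜ[R] x} := by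
  rw [Ideal.mem_span_singleton']
  constructor
  · intro hz
    obtain ⟨a, b, rfl⟩ := exists_eq_tmul_one_add_tmul hspan z
    have key : a + b * x = 0 := by
      have h := congrArg ((_root_.TensorProduct.rid R A).toLinearMap ∘ₗ φ.lTensor A) hz
      simp only [add_mul, mul_sub, mul_add, tmul_mul_tmul, mul_smul_comm, one_mul, mul_one, hx,
        TensorProduct.tmul_add, TensorProduct.tmul_smul] at h
      simp only [map_add, map_sub, map_smul, map_zero, LinearMap.comp_apply,
        LinearEquiv.coe_coe, LinearMap.lTensor_tmul, _root_.TensorProduct.rid_tmul, φ_one, φ_x,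
        zero_smul, smul_zero, one_smul, zero_add, add_zero] at h
      linear_combination h
    refine ⟨-(b ⊗ₜ[R] 1), ?_⟩
    rw [eq_neg_of_add_eq_zero_left key, mul_sub, neg_mul, neg_mul, tmul_mul_tmul, tmul_mul_tmul,
      mul_one, mul_one, one_mul, TensorProduct.neg_tmul]
    abel
  · rintro ⟨c, rfl⟩
    have h₁ : (x ⊗ₜ[R] (1 : A)) * x ⊗ₜ[R] 1 = m • x ⊗ₜ[R] 1 + n • 1 := by
      rw [tmul_mul_tmul, hx, mul_one, TensorProduct.add_tmul, ← TensorProduct.smul_tmul',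
        ← TensorProduct.smul_tmul', one_def]
    have h₂ : ((1 : A) ⊗ₜ[R] x) * 1 ⊗ₜ[R] x = m • 1 ⊗ₜ[R] x + n • 1 := by
      rw [tmul_mul_tmul, hx, mul_one, TensorProduct.tmul_add, TensorProduct.tmul_smul,
        TensorProduct.tmul_smul, one_def]
    rw [← one_def]
    simp only [Algebra.smul_def] at h₁ h₂ ⊢
    linear_combination c * h₁ - c * h₂

end Algebra.TensorProduct

theorem envX_mul_self (m n : ℤ) : envX m n * envX m n = m • envX m n + n • 1 := by
  have h : (Ideal.Quotient.mk (Ideal.span ({X ^ 2 - C m * X - C n} : Set ℤ[X])))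
      (X ^ 2 - C m * X - C n) = 0 :=
    Ideal.Quotient.eq_zero_iff_mem.2 (Ideal.subset_span rfl)
  simp only [map_sub, map_mul, map_pow, eq_intCast, map_intCast] at h
  change envX m n ^ 2 - m * envX m n - n = 0 at h
  simp only [zsmul_eq_mul, mul_one]
  linear_combination h

namespace EnvRing

theorem exists_eq_zsmul_add (m n : ℤ) (t : EnvRing m n) :
    ∃ p q : ℤ, t = p • 1 + q • envX m n := by
  obtain ⟨f, rfl⟩ := Ideal.Quotient.mk_surjective t
  induction f using Polynomial.induction_on with
  | C a => exact ⟨a, 0, by simp⟩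
  | add f g hf hg =>
    obtain ⟨p, q, h⟩ := hf
    obtain ⟨p', q', h'⟩ := hg
    exact ⟨p + p', q + q', by rw [map_add, h, h']; module⟩
  | monomial k a h =>
    obtain ⟨p, q, h⟩ := h
    refine ⟨q * n, p + q * m, ?_⟩
    rw [pow_succ (X : ℤ[X]) k, ← mul_assoc, map_mul, h]
    change _ * envX m n = _
    rw [add_mul, smul_mul_assoc, smul_mul_assoc, envX_mul_self, one_mul]
    module

/-- The action of the enveloping ring on itself by multiplication, in the basis `1, x`. -/
noncomputable def toMatrix (m n : ℤ) : EnvRing m n →+* Matrix (Fin 2) (Fin 2) ℤ :=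
  Ideal.Quotient.lift _ (aeval (!![0, n; 1, m] : Matrix (Fin 2) (Fin 2) ℤ)).toRingHom <| by
    refine fun a ha ↦ (Ideal.span_le (I := RingHom.ker _)).2 ?_ ha
    rw [Set.singleton_subset_iff, SetLike.mem_coe, RingHom.mem_ker]
    ext i j
    fin_cases i <;> fin_cases j <;>
      simp [pow_two, Matrix.mul_apply, Matrix.intCast_apply, mul_comm]

theorem toMatrix_envX (m n : ℤ) : toMatrix m n (envX m n) = !![0, n; 1, m] := by
  simp [toMatrix, envX]

/-- The coefficient of `x` in the basis `1, x` of the enveloping ring. -/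
noncomputable def coeffX (m n : ℤ) : EnvRing m n →ₗ[ℤ] ℤ :=
  (Matrix.entryLinearMap ℤ ℤ 1 0).comp (toMatrix m n).toAddMonoidHom.toIntLinearMap

theorem coeffX_one (m n : ℤ) : coeffX m n 1 = 0 := by
  simp [coeffX]

theorem coeffX_envX (m n : ℤ) : coeffX m n (envX m n) = 1 := by
  simp [coeffX, toMatrix_envX]

end EnvRing

/-- in `B = A ⊗_ℤ A`, with `u = x ⊗ 1 − 1 ⊗ x` and
`v = x ⊗ 1 + 1 ⊗ x − m·(1 ⊗ 1)`, the annihilator of `v` is the principal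
ideal generated by `u`. -/
theorem annihilator_v_eq_span_u (m n : ℤ) :
    let B := EnvRing m n ⊗[ℤ] EnvRing m n
    let u : B := envX m n ⊗ₜ[ℤ] 1 - 1 ⊗ₜ[ℤ] envX m n
    let v : B := envX m n ⊗ₜ[ℤ] 1 + 1 ⊗ₜ[ℤ] envX m n -
      (m : ℤ) • ((1 : EnvRing m n) ⊗ₜ[ℤ] (1 : EnvRing m n))
    ∀ z : B, z * v = 0 ↔ z ∈ Ideal.span ({u} : Set B) := by
  intro B u v z
  exact Algebra.TensorProduct.mul_eq_zero_iff_mem_span_of_quadratic (envX_mul_self m n)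
    (EnvRing.exists_eq_zsmul_add m n) (EnvRing.coeffX m n) (EnvRing.coeffX_one m n)
    (EnvRing.coeffX_envX m n) z
end
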